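/- Fix p ∈ [1,∞) and t₂ < 1/p. The map [0,∞) ∋ t ↦ Λ_p(√t, t₂) is concave but not affine if p > 2, affine if p = 2, and convex but not affine if p < 2. -/

import Mathlib

open MeasureTheory Filter Topology Set ProbabilityTheory
open scoped ENNReal NNReal

noncomputable section

namespace LDP

/-- The nonnegative part of an extended real, as an extended nonnegative real. -/
def erealToENNReal (x : EReal) : ℝ≥0∞ := if x = ⊤ then ⊤ else ENNReal.ofReal x.toReal

/-- Extended (possibly infinite) integral of an `EReal`-valued function:
positive part minus negative part. -/
def eIntegral (ν : Measure ℝ) (f : ℝ → EReal) : EReal :=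
  ((∫⁻ u, erealToENNReal (f u) ∂ν : ℝ≥0∞) : EReal)
    - ((∫⁻ u, erealToENNReal (-f u) ∂ν : ℝ≥0∞) : EReal)

/-- `q`-th absolute moment of a measure on `ℝ`. -/
def mom (q : ℝ) (ν : Measure ℝ) : ℝ≥0∞ := ∫⁻ x, ENNReal.ofReal (|x| ^ q) ∂ν

open Classical in
/-- Relative entropy `H(ν|μ)`. -/
def relEnt (ν μ : Measure ℝ) : EReal :=
  if ν ≪ μ then eIntegral ν (fun x => ENNReal.log (ν.rnDeriv μ x)) else ⊤

/-- The generalized normal distribution `μ_p` on `ℝ`. -/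
def muP (p : ℝ) : Measure ℝ :=
  volume.withDensity fun y =>
    ENNReal.ofReal ((2 * p ^ (1/p) * Real.Gamma (1 + 1/p))⁻¹ * Real.exp (-(|y| ^ p) / p))

/-- The uniform probability measure `μ_∞` on `[-1,1]`. -/
def muInf : Measure ℝ := (volume (Icc (-1:ℝ) 1))⁻¹ • volume.restrict (Icc (-1:ℝ) 1)

/-- Extended-real-valued log moment generating function of a measure on `ℝ`. -/
def logM (γ : Measure ℝ) (t : ℝ) : EReal :=
  ENNReal.log (∫⁻ y, ENNReal.ofReal (Real.exp (t * y)) ∂γ)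

/-- The class `𝒯_q` of measures whose log mgf is dominated by `C|t|^{q/(q-1)} + C`. -/
def memT (q : ℝ) (γ : Measure ℝ) : Prop :=
  ∃ C : ℝ, ∀ t : ℝ, logM γ t ≤ ((C * |t| ^ (q/(q-1)) + C : ℝ) : EReal)

/-- Legendre transform of a function of one real variable. -/
def legendre1 (Λ : ℝ → EReal) (τ : ℝ) : EReal := ⨆ t : ℝ, ((t * τ : ℝ) : EReal) - Λ t

/-- Legendre transform of a function of two real variables. -/
def legendre2 (Λ : ℝ × ℝ → EReal) (τ : ℝ × ℝ) : EReal :=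
  ⨆ t : ℝ × ℝ, ((t.1 * τ.1 + t.2 * τ.2 : ℝ) : EReal) - Λ t

/-- Legendre transform of a function of three real variables. -/
def legendre3 (Λ : ℝ × ℝ × ℝ → EReal) (τ : ℝ × ℝ × ℝ) : EReal :=
  ⨆ t : ℝ × ℝ × ℝ, ((t.1 * τ.1 + t.2.1 * τ.2.1 + t.2.2 * τ.2.2 : ℝ) : EReal) - Λ t

/-- `Φ_p(t₀,t₁,t₂) = log ∫∫ exp(t₀ z² + t₁ z y + t₂ |y|^p) μ₂(dz) μ_p(dy)`. -/
def Phi (p : ℝ) (t : ℝ × ℝ × ℝ) : EReal :=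
  ENNReal.log (∫⁻ y, (∫⁻ z,
    ENNReal.ofReal (Real.exp (t.1 * z^2 + t.2.1 * z * y + t.2.2 * |y| ^ p)) ∂(muP 2)) ∂(muP p))

/-- The annealed rate function `𝕀ᵃ_p` for `p ∈ [2,∞)`. -/
def Ia (p : ℝ) (w : ℝ) : EReal :=
  ⨅ τ ∈ {τ : ℝ × ℝ × ℝ | 0 < τ.1 ∧ 0 < τ.2.2 ∧
      τ.1 ^ (-(1:ℝ)/2) * τ.2.1 * τ.2.2 ^ (-(1:ℝ)/p) = w},
    legendre3 (Phi p) τ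

/-- `Λ_p(t₁,t₂) = log ∫ exp(t₁ y + t₂|y|^p) μ_p(dy)`. -/
def LamP (p : ℝ) (t : ℝ × ℝ) : EReal :=
  ENNReal.log (∫⁻ y, ENNReal.ofReal (Real.exp (t.1 * y + t.2 * |y| ^ p)) ∂(muP p))

/-- `Ψ_{p,ν}(t₁,t₂) = ∫ Λ_p(t₁ u, t₂) ν(du)`. -/
def Psi (p : ℝ) (ν : Measure ℝ) (t : ℝ × ℝ) : EReal :=
  eIntegral ν (fun u => LamP p (t.1 * u, t.2))

/-- The quenched rate function `𝕀^q_{p,ν}`. -/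
def Iq (p : ℝ) (ν : Measure ℝ) (w : ℝ) : EReal :=
  ⨅ τ ∈ {τ : ℝ × ℝ | 0 < τ.2 ∧ τ.1 * τ.2 ^ (-(1:ℝ)/p) = w}, legendre2 (Psi p ν) τ

/-- The Cramér-type rate function `𝕀^{cr}_p`. -/
def Icr (p : ℝ) (w : ℝ) : EReal :=
  ⨅ τ ∈ {τ : ℝ × ℝ | 0 < τ.2 ∧ τ.1 * τ.2 ^ (-(1:ℝ)/p) = w}, legendre2 (LamP p) τ

/-- `Φ_γ(t₀,t₁) = log ∫∫ exp(t₀ z² + t₁ z x) μ₂(dz) γ(dx)`. -/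
def Phig (γ : Measure ℝ) (t : ℝ × ℝ) : EReal :=
  ENNReal.log (∫⁻ x, (∫⁻ z,
    ENNReal.ofReal (Real.exp (t.1 * z^2 + t.2 * z * x)) ∂(muP 2)) ∂γ)

/-- The annealed rate function `𝕀ᵃ_γ` for a product measure `γ^{⊗n}`. -/
def Iag (γ : Measure ℝ) (w : ℝ) : EReal :=
  ⨅ τ ∈ {τ : ℝ × ℝ | 0 < τ.1 ∧ τ.1 ^ (-(1:ℝ)/2) * τ.2 = w}, legendre2 (Phig γ) τ

/-- `Ψ_{γ,ν}(t) = ∫ log M_γ(t u) ν(du)`. -/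
def Psig (γ ν : Measure ℝ) (t : ℝ) : EReal := eIntegral ν (fun u => logM γ (t * u))

/-- The quenched rate function `𝕀^q_{γ,ν}` for a product measure. -/
def Iqg (γ ν : Measure ℝ) : ℝ → EReal := legendre1 (Psig γ ν)

/-- `Ψ_{∞,ν}`. -/
def PsiInf (ν : Measure ℝ) : ℝ → EReal := Psig muInf ν

/-- `𝕀^q_{∞,ν}`. -/
def IqInf (ν : Measure ℝ) : ℝ → EReal := legendre1 (PsiInf ν)

/-- `𝕀ᵃ_∞`. -/
def IaInf : ℝ → EReal := Iag muInf

/-- Euclidean inner product on `ℝⁿ`. -/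
def dotp {n : ℕ} (x y : Fin n → ℝ) : ℝ := ∑ i, x i * y i

/-- The unit ℓ^p ball of `ℝⁿ`. -/
def lpBall (n : ℕ) (p : ℝ) : Set (Fin n → ℝ) := {x | ∑ i, |x i| ^ p ≤ 1}

/-- The uniform probability measure on the unit ℓ^p ball. -/
def uniformLpBall (n : ℕ) (p : ℝ) : Measure (Fin n → ℝ) :=
  (volume (lpBall n p))⁻¹ • volume.restrict (lpBall n p)

/-- The unit Euclidean sphere in `ℝⁿ`. -/
def unitSphereSet (n : ℕ) : Set (Fin n → ℝ) := {x | ∑ i, (x i)^2 = 1}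

/-- `μ` is the (unique) rotation-invariant probability measure on the unit sphere `S^{n-1}`. -/
def IsUniformSphere {n : ℕ} (μ : Measure (Fin n → ℝ)) : Prop :=
  IsProbabilityMeasure μ ∧ μ (unitSphereSet n) = 1 ∧
    ∀ O : Matrix.orthogonalGroup (Fin n) ℝ,
      Measure.map (fun x => (O : Matrix (Fin n) (Fin n) ℝ).mulVec x) μ = μ

/-- A large deviation principle with speed `s` and rate function `I`. -/
def IsLDP {Ω : Type*} [MeasurableSpace Ω] (P : Measure Ω)
    (ξ : ℕ → Ω → ℝ) (s : ℕ → ℝ) (I : ℝ → EReal) : Prop :=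
  LowerSemicontinuous I ∧
    ∀ Γ : Set ℝ, MeasurableSet Γ →
      (-(⨅ x ∈ interior Γ, I x) ≤
        atTop.liminf fun n =>
          (((s n)⁻¹ : ℝ) : EReal) * ENNReal.log (P {ω | ξ n ω ∈ interior Γ})) ∧
      ((atTop.limsup fun n =>
          (((s n)⁻¹ : ℝ) : EReal) * ENNReal.log (P {ω | ξ n ω ∈ closure Γ})) ≤
        -(⨅ x ∈ closure Γ, I x))

/-- Goodness of a rate function: compact sublevel sets. -/
def HasCompactSublevels (I : ℝ → EReal) : Prop := ∀ c : ℝ, IsCompact {x | I x ≤ (c : EReal)}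

/-- Quasiconvexity: convex sublevel sets. -/
def QuasiconvexRate (I : ℝ → EReal) : Prop := ∀ c : EReal, Convex ℝ {x | I x ≤ c}

/-- Symmetry: `I(-w) = I(w)`. -/
def SymmetricRate (I : ℝ → EReal) : Prop := ∀ w : ℝ, I (-w) = I w

/-- Convexity of an extended-real-valued rate function. -/
def ConvexRate (I : ℝ → EReal) : Prop :=
  ∀ x y a b : ℝ, 0 ≤ a → 0 ≤ b → a + b = 1 →
    I (a * x + b * y) ≤ (a : EReal) * I x + (b : EReal) * I y

/-- Convexity on a set, for extended-real-valued functions. -/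
def ConvexOnE (s : Set ℝ) (g : ℝ → EReal) : Prop :=
  ∀ x ∈ s, ∀ y ∈ s, ∀ a b : ℝ, 0 ≤ a → 0 ≤ b → a + b = 1 →
    g (a * x + b * y) ≤ (a : EReal) * g x + (b : EReal) * g y

/-- Concavity on a set, for extended-real-valued functions. -/
def ConcaveOnE (s : Set ℝ) (g : ℝ → EReal) : Prop :=
  ∀ x ∈ s, ∀ y ∈ s, ∀ a b : ℝ, 0 ≤ a → 0 ≤ b → a + b = 1 →
    (a : EReal) * g x + (b : EReal) * g y ≤ g (a * x + b * y)

/-- Strict convexity, for extended-real-valued functions. -/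
def StrictConvexE (g : ℝ → EReal) : Prop :=
  ∀ x y : ℝ, x ≠ y → ∀ a b : ℝ, 0 < a → 0 < b → a + b = 1 →
    g (a * x + b * y) < (a : EReal) * g x + (b : EReal) * g y

/-- The property of agreeing with a real affine function on a set. -/
def AffineOnE (s : Set ℝ) (g : ℝ → EReal) : Prop :=
  ∃ m q : ℝ, ∀ t ∈ s, g t = ((m * t + q : ℝ) : EReal)

/-- Empirical measure `L_{n,θ} = (1/n) Σ δ_{√n θ_i}`. -/
def empMeas (n : ℕ) (θn : Fin n → ℝ) : Measure ℝ :=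
  ((n : ℝ≥0∞))⁻¹ • ∑ i : Fin n, Measure.dirac (Real.sqrt n * θn i)

end LDP

open LDP

/-- Euler's approximants to `Γ` satisfy the scaling inequality of
`gamma_mul_gamma_mul_sq_le`. -/
lemma gammaSeq_mul_gammaSeq_mul_sq_le {x u v i : ℝ} (hx : 0 < x) (hu : 0 < u) (huv : u ≤ v)
    (hi : 0 ≤ i) {n : ℕ} (hn : 0 < n) :
    Real.GammaSeq (u * x + i) n * Real.GammaSeq (u * (x + 2) + i) n
        * Real.GammaSeq (v * (x + 1) + i) n ^ 2
      ≤ Real.GammaSeq (u * (x + 1) + i) n ^ 2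
        * (Real.GammaSeq (v * x + i) n * Real.GammaSeq (v * (x + 2) + i) n) := by
  have hv : 0 < v := hu.trans_le huv
  have hn' : (0 : ℝ) < n := by exact_mod_cast hn
  have hpow : ∀ w : ℝ, (n : ℝ) ^ (w * x + i) * (n : ℝ) ^ (w * (x + 2) + i)
      = ((n : ℝ) ^ (w * (x + 1) + i)) ^ 2 := by
    intro w
    rw [← Real.rpow_add hn', ← Real.rpow_natCast, ← Real.rpow_mul hn'.le]
    congr 1
    push_cast
    ring
  have hpos : ∀ w : ℝ, 0 < w → 0 < ∏ j ∈ Finset.range (n + 1), (w + i + (j : ℝ)) := by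
    intro w hw
    exact Finset.prod_pos fun j _ => by positivity
  have hprod : (∏ j ∈ Finset.range (n + 1), (u * (x + 1) + i + (j : ℝ))) ^ 2
        * ((∏ j ∈ Finset.range (n + 1), (v * x + i + (j : ℝ)))
          * ∏ j ∈ Finset.range (n + 1), (v * (x + 2) + i + (j : ℝ)))
      ≤ (∏ j ∈ Finset.range (n + 1), (u * x + i + (j : ℝ)))
          * (∏ j ∈ Finset.range (n + 1), (u * (x + 2) + i + (j : ℝ)))
          * (∏ j ∈ Finset.range (n + 1), (v * (x + 1) + i + (j : ℝ))) ^ 2 := by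
    simp only [← Finset.prod_pow, ← Finset.prod_mul_distrib]
    refine Finset.prod_le_prod (fun j _ => by positivity) fun j _ => ?_
    set b : ℝ := i + j with hb
    have hb0 : 0 ≤ b := by positivity
    have h1 : (v * (x + 1) + b) * u ≤ (u * (x + 1) + b) * v := by
      nlinarith [mul_le_mul_of_nonneg_right huv hb0]
    have h2 : ((v * (x + 1) + b) * u) ^ 2 ≤ ((u * (x + 1) + b) * v) ^ 2 :=
      pow_le_pow_left₀ (by positivity) h1 2
    simp only [add_assoc, ← hb] at *
    nlinarith [h2]
  simp only [Real.GammaSeq]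
  have hu1 := hpos (u * x) (by positivity)
  have hu2 := hpos (u * (x + 2)) (by positivity)
  have hu3 := hpos (u * (x + 1)) (by positivity)
  have hv1 := hpos (v * x) (by positivity)
  have hv2 := hpos (v * (x + 2)) (by positivity)
  have hv3 := hpos (v * (x + 1)) (by positivity)
  set U1 := ∏ j ∈ Finset.range (n + 1), (u * x + i + (j : ℝ))
  set U2 := ∏ j ∈ Finset.range (n + 1), (u * (x + 2) + i + (j : ℝ))
  set U3 := ∏ j ∈ Finset.range (n + 1), (u * (x + 1) + i + (j : ℝ))
  set V1 := ∏ j ∈ Finset.range (n + 1), (v * x + i + (j : ℝ))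
  set V2 := ∏ j ∈ Finset.range (n + 1), (v * (x + 2) + i + (j : ℝ))
  set V3 := ∏ j ∈ Finset.range (n + 1), (v * (x + 1) + i + (j : ℝ))
  set P : ℝ := ((n : ℝ) ^ (u * (x + 1) + i)) ^ 2 * ((n : ℝ) ^ (v * (x + 1) + i)) ^ 2
    * (n.factorial : ℝ) ^ 4
  have hP : 0 ≤ P := by positivity
  calc _ = ((n : ℝ) ^ (u * x + i) * (n : ℝ) ^ (u * (x + 2) + i))
        * ((n : ℝ) ^ (v * (x + 1) + i)) ^ 2 * (n.factorial : ℝ) ^ 4 / (U1 * U2 * V3 ^ 2) := by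
        field_simp
    _ = P / (U1 * U2 * V3 ^ 2) := by rw [hpow u]
    _ ≤ P / (U3 ^ 2 * (V1 * V2)) := div_le_div_of_nonneg_left hP (by positivity) hprod
    _ = ((n : ℝ) ^ (u * (x + 1) + i)) ^ 2 * ((n : ℝ) ^ (v * x + i) * (n : ℝ) ^ (v * (x + 2) + i))
        * (n.factorial : ℝ) ^ 4 / (U3 ^ 2 * (V1 * V2)) := by rw [hpow v]
    _ = _ := by field_simp

/-- The ratio `Γ(u x + i) Γ(u (x + 2) + i) / Γ(u (x + 1) + i) ^ 2` is monotone in `u`. -/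
lemma gamma_mul_gamma_mul_sq_le {x u v i : ℝ} (hx : 0 < x) (hu : 0 < u) (huv : u ≤ v)
    (hi : 0 ≤ i) :
    Real.Gamma (u * x + i) * Real.Gamma (u * (x + 2) + i) * Real.Gamma (v * (x + 1) + i) ^ 2
      ≤ Real.Gamma (u * (x + 1) + i) ^ 2
        * (Real.Gamma (v * x + i) * Real.Gamma (v * (x + 2) + i)) := by
  have T := Real.GammaSeq_tendsto_Gamma
  refine le_of_tendsto_of_tendsto (((T _).mul (T _)).mul ((T _).pow 2))
    (((T _).pow 2).mul ((T _).mul (T _))) ?_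
  filter_upwards [eventually_gt_atTop 0] with n hn
  exact gammaSeq_mul_gammaSeq_mul_sq_le hx hu huv hi hn

/-- The ratio `Γ(u x) Γ(u (x + 2)) / Γ(u (x + 1)) ^ 2` is strictly increasing in `u`. -/
lemma gamma_mul_gamma_mul_sq_lt {x u v : ℝ} (hx : 0 < x) (hu : 0 < u) (huv : u < v) :
    Real.Gamma (u * x) * Real.Gamma (u * (x + 2)) * Real.Gamma (v * (x + 1)) ^ 2
      < Real.Gamma (u * (x + 1)) ^ 2 * (Real.Gamma (v * x) * Real.Gamma (v * (x + 2))) := by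
  have hv : 0 < v := hu.trans huv
  have hshift : ∀ z : ℝ, 0 < z → Real.Gamma (z + 2) = (z + 1) * z * Real.Gamma z := by
    intro z hz
    rw [show z + 2 = z + 1 + 1 by ring, Real.Gamma_add_one (by positivity),
      Real.Gamma_add_one hz.ne']
    ring
  have h := gamma_mul_gamma_mul_sq_le hx hu huv.le zero_le_two
  rw [hshift _ (by positivity : 0 < u * x), hshift _ (by positivity : 0 < u * (x + 2)),
    hshift _ (by positivity : 0 < u * (x + 1)), hshift _ (by positivity : 0 < v * x),
    hshift _ (by positivity : 0 < v * (x + 2)), hshift _ (by positivity : 0 < v * (x + 1))] at h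
  have g1 : 0 < Real.Gamma (u * (x + 1)) := Real.Gamma_pos_of_pos (by positivity)
  have g2 : 0 < Real.Gamma (v * x) := Real.Gamma_pos_of_pos (by positivity)
  have g3 : 0 < Real.Gamma (v * (x + 2)) := Real.Gamma_pos_of_pos (by positivity)
  have hfac : (u * (x + 1) + 1) ^ 2 * ((v * x + 1) * (v * (x + 2) + 1))
      < (u * x + 1) * (u * (x + 2) + 1) * (v * (x + 1) + 1) ^ 2 := by
    have h1 : (v * (x + 1) + 1) * u < (u * (x + 1) + 1) * v := by nlinarith
    have h2 : ((v * (x + 1) + 1) * u) ^ 2 < ((u * (x + 1) + 1) * v) ^ 2 :=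
      pow_lt_pow_left₀ h1 (by positivity) two_ne_zero
    nlinarith [h2]
  set L := Real.Gamma (u * x) * Real.Gamma (u * (x + 2)) * Real.Gamma (v * (x + 1)) ^ 2
  set R := Real.Gamma (u * (x + 1)) ^ 2 * (Real.Gamma (v * x) * Real.Gamma (v * (x + 2)))
  have hR : 0 < R := by positivity
  set A := (u * (x + 1) + 1) ^ 2 * ((v * x + 1) * (v * (x + 2) + 1))
  set B := (u * x + 1) * (u * (x + 2) + 1) * (v * (x + 1) + 1) ^ 2
  have hA : 0 < A := by positivity
  set D := u * x * (u * (x + 2)) * (v * (x + 1)) ^ 2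
  have hD : 0 < D := by positivity
  have hDR : (u * (x + 1)) ^ 2 * (v * x * (v * (x + 2))) = D := by ring
  have h' : D * (B * L) ≤ D * (A * R) := by
    calc D * (B * L) = _ := by ring
      _ ≤ _ := h
      _ = ((u * (x + 1)) ^ 2 * (v * x * (v * (x + 2)))) * (A * R) := by ring
      _ = _ := by rw [hDR]
  have h'' := le_of_mul_le_mul_left h' hD
  have : B * L < B * R := h''.trans_lt (mul_lt_mul_of_pos_right hfac hR)
  exact lt_of_mul_lt_mul_left this (hA.trans hfac).le

/-- The exponential generating function of a real sequence. -/
def expGen (c : ℕ → ℝ) (t : ℝ) : ℝ := ∑' k, c k * t ^ k / (k.factorial : ℝ)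

lemma succ_mul_pow_mul_le_add_pow {r δ : ℝ} (hr : 0 ≤ r) (hδ : 0 ≤ δ) (k : ℕ) :
    (k + 1) * r ^ k * δ ≤ (r + δ) ^ (k + 1) := by
  have h : ∀ k : ℕ, (k + 1) * r ^ k * δ + r ^ (k + 1) ≤ (r + δ) ^ (k + 1) := by
    intro k
    induction k with
    | zero => simp [add_comm]
    | succ k ih =>
      have h1 := mul_le_mul_of_nonneg_right ih (add_nonneg hr hδ)
      have h2 : 0 ≤ (k + 1) * r ^ k * δ * δ := by positivity
      push_cast
      rw [pow_succ (r + δ) (k + 1)]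
      refine le_trans ?_ h1
      have : ((k + 1) * r ^ k * δ + r ^ (k + 1)) * (r + δ)
        = (k + 1 + 1) * r ^ (k + 1) * δ + r ^ (k + 1 + 1) + (k + 1) * r ^ k * δ * δ := by ring
      linarith
  exact le_trans (le_add_of_nonneg_right (by positivity)) (h k)

section

variable {c : ℕ → ℝ} {R : ℝ}

lemma summable_expGen_of_le (hc : ∀ k, 0 ≤ c k)
    (hs : Summable fun k => c k * R ^ k / (k.factorial : ℝ)) {r : ℝ} (hr : 0 ≤ r) (hrR : r ≤ R) :
    Summable fun k => c k * r ^ k / (k.factorial : ℝ) :=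
  hs.of_nonneg_of_le (fun k => by have := hc k; positivity) fun k => by
    have := hc k
    gcongr

lemma summable_expGen_succ (hc : ∀ k, 0 ≤ c k)
    (hs : Summable fun k => c k * R ^ k / (k.factorial : ℝ)) {r : ℝ} (hr : 0 ≤ r) (hrR : r < R) :
    Summable fun k => c (k + 1) * r ^ k / (k.factorial : ℝ) := by
  have h1 := ((summable_nat_add_iff 1).2 hs).mul_left (R - r)⁻¹
  refine h1.of_nonneg_of_le (fun k => by have := hc (k + 1); positivity) fun k => ?_
  have hδ : 0 < R - r := sub_pos.2 hrR
  have h2 := succ_mul_pow_mul_le_add_pow hr hδ.le k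
  rw [add_sub_cancel] at h2
  have h3 := hc (k + 1)
  rw [Nat.factorial_succ]
  push_cast
  rw [inv_mul_eq_div, le_div_iff₀ hδ]
  have hf : (0 : ℝ) < k.factorial := by exact_mod_cast k.factorial_pos
  calc c (k + 1) * r ^ k / k.factorial * (R - r)
      = c (k + 1) * ((k + 1) * r ^ k * (R - r)) / ((k + 1) * k.factorial) := by
        field_simp
    _ ≤ _ := by gcongr

lemma hasDerivAt_expGen (hc : ∀ k, 0 ≤ c k)
    (hs : Summable fun k => c k * R ^ k / (k.factorial : ℝ)) {t : ℝ} (ht : |t| < R) :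
    HasDerivAt (expGen c) (expGen (fun k => c (k + 1)) t) t := by
  obtain ⟨r, htr, hrR⟩ := exists_between ht
  have hr : 0 < r := (abs_nonneg t).trans_lt htr
  have h1 := summable_expGen_succ hc hs hr.le hrR
  have hder : ∀ k : ℕ, ∀ y : ℝ, HasDerivAt (fun y => c (k + 1) * y ^ (k + 1) / ((k + 1).factorial : ℝ))
      (c (k + 1) * y ^ k / (k.factorial : ℝ)) y := by
    intro k y
    have h := ((hasDerivAt_pow (k + 1) y).const_mul (c (k + 1))).div_const ((k + 1).factorial : ℝ)
    refine h.congr_deriv ?_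
    rw [Nat.factorial_succ]
    push_cast
    have hf : (0 : ℝ) < k.factorial := by exact_mod_cast k.factorial_pos
    field_simp
  have hmem : ∀ y ∈ Metric.ball (0 : ℝ) r, |y| < r := fun y hy => by
    simpa [Metric.mem_ball, dist_zero_right] using hy
  have hbase : ∀ y ∈ Metric.ball (0 : ℝ) r, Summable fun k => c k * y ^ k / (k.factorial : ℝ) := by
    intro y hy
    refine Summable.of_norm ?_
    have := summable_expGen_of_le hc hs (abs_nonneg y) ((hmem y hy).trans hrR).le
    refine this.congr fun k => ?_
    simp [abs_of_nonneg (hc k)]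
  have h2 := hasDerivAt_tsum_of_isPreconnected (t := Metric.ball (0 : ℝ) r) (y₀ := 0) (y := t)
    (g := fun k y => c (k + 1) * y ^ (k + 1) / ((k + 1).factorial : ℝ)) h1 Metric.isOpen_ball
    (convex_ball (0 : ℝ) r).isPreconnected (fun k y _ => hder k y)
    (fun k y hy => by
      have := hmem y hy
      have h3 := hc (k + 1)
      simp only [norm_div, norm_mul, norm_pow, Real.norm_eq_abs, abs_of_nonneg h3, Nat.abs_cast]
      gcongr)
    (by simpa using hr) (by simp) (by simpa [Metric.mem_ball, dist_zero_right] using htr)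
  refine (h2.const_add (c 0)).congr_of_eventuallyEq ?_
  filter_upwards [Metric.isOpen_ball.mem_nhds
    (by simpa [Metric.mem_ball, dist_zero_right] using htr : t ∈ Metric.ball (0 : ℝ) r)] with y hy
  simp [expGen, (hbase y hy).tsum_eq_zero_add]

end

/-- If the ratio of the coefficients of two power series is antitone, then so is the ratio
of their sums. -/
lemma expGen_mul_le_mul {a b : ℕ → ℝ} {s t : ℝ} (ha : ∀ k, 0 ≤ a k) (hb : ∀ k, 0 ≤ b k)
    (hab : ∀ i j, i ≤ j → a j * b i ≤ a i * b j) (hs : 0 ≤ s) (hst : s ≤ t)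
    (hsa : Summable fun k => a k * t ^ k / (k.factorial : ℝ))
    (hsb : Summable fun k => b k * t ^ k / (k.factorial : ℝ)) :
    expGen a t * expGen b s ≤ expGen a s * expGen b t := by
  have ht : 0 ≤ t := hs.trans hst
  have norm_of : ∀ {c : ℕ → ℝ} {r : ℝ}, (∀ k, 0 ≤ c k) → 0 ≤ r → r ≤ t →
      (Summable fun k => c k * t ^ k / (k.factorial : ℝ)) →
      Summable fun k => ‖c k * r ^ k / (k.factorial : ℝ)‖ := fun hc hr hrt h =>
    (summable_expGen_of_le hc h hr hrt).norm
  have hat := norm_of ha ht le_rfl hsa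
  have has := norm_of ha hs hst hsa
  have hbt := norm_of hb ht le_rfl hsb
  have hbs := norm_of hb hs hst hsb
  have S1 := summable_mul_of_summable_norm hat hbs
  have S2 := summable_mul_of_summable_norm has hbt
  have S1' := (Equiv.prodComm ℕ ℕ).summable_iff.2 S1
  have S2' := (Equiv.prodComm ℕ ℕ).summable_iff.2 S2
  unfold expGen
  rw [tsum_mul_tsum_of_summable_norm hat hbs, tsum_mul_tsum_of_summable_norm has hbt]
  have E1 := (Equiv.prodComm ℕ ℕ).tsum_eq
    fun z : ℕ × ℕ => a z.1 * t ^ z.1 / (z.1.factorial : ℝ) * (b z.2 * s ^ z.2 / (z.2.factorial : ℝ))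
  have E2 := (Equiv.prodComm ℕ ℕ).tsum_eq
    fun z : ℕ × ℕ => a z.1 * s ^ z.1 / (z.1.factorial : ℝ) * (b z.2 * t ^ z.2 / (z.2.factorial : ℝ))
  have key := (S1.add S1').tsum_le_tsum (fun z => ?_) (S2.add S2')
  · rw [S1.tsum_add S1', S2.tsum_add S2'] at key
    simp only [Function.comp_def] at key
    rw [E1, E2] at key
    linarith
  · obtain ⟨i, j⟩ := z
    simp only [Function.comp_def, Equiv.prodComm_apply, Prod.swap_prod_mk]
    have hmain : (a i * b j - a j * b i) * (t ^ i * s ^ j - t ^ j * s ^ i) ≤ 0 := by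
      have hpow : ∀ i j : ℕ, i ≤ j → t ^ i * s ^ j ≤ t ^ j * s ^ i := by
        intro i j hij
        obtain ⟨d, rfl⟩ := Nat.exists_eq_add_of_le hij
        have : s ^ d ≤ t ^ d := pow_le_pow_left₀ hs hst d
        have h0 : 0 ≤ t ^ i * s ^ i := by positivity
        calc t ^ i * s ^ (i + d) = t ^ i * s ^ i * s ^ d := by ring
          _ ≤ t ^ i * s ^ i * t ^ d := by gcongr
          _ = _ := by ring
      rcases le_total i j with h | h
      · exact mul_nonpos_of_nonneg_of_nonpos (sub_nonneg.2 (hab i j h)) (sub_nonpos.2 (hpow i j h))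
      · refine mul_nonpos_of_nonpos_of_nonneg (sub_nonpos.2 ?_) (sub_nonneg.2 ?_)
        · linarith [hab j i h]
        · linarith [hpow j i h]
    have hi : (0 : ℝ) < i.factorial := by exact_mod_cast i.factorial_pos
    have hj : (0 : ℝ) < j.factorial := by exact_mod_cast j.factorial_pos
    rw [← sub_nonpos]
    have : a i * t ^ i / (i.factorial : ℝ) * (b j * s ^ j / j.factorial)
          + a j * t ^ j / (j.factorial : ℝ) * (b i * s ^ i / i.factorial)
          - (a i * s ^ i / (i.factorial : ℝ) * (b j * t ^ j / j.factorial)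
          + a j * s ^ j / (j.factorial : ℝ) * (b i * t ^ i / i.factorial))
        = (a i * b j - a j * b i) * (t ^ i * s ^ j - t ^ j * s ^ i)
          / (i.factorial * j.factorial) := by
      field_simp
      ring
    rw [this]
    exact div_nonpos_of_nonpos_of_nonneg hmain (by positivity)

section

variable {c : ℕ → ℝ} {R : ℝ}

lemma expGen_pos (hc : ∀ k, 0 < c k) (hs : Summable fun k => c k * R ^ k / (k.factorial : ℝ))
    {t : ℝ} (ht : 0 ≤ t) (htR : t ≤ R) : 0 < expGen c t := by
  refine (summable_expGen_of_le (fun k => (hc k).le) hs ht htR).tsum_pos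
    (fun k => by have := (hc k).le; positivity) 0 ?_
  simpa using hc 0

lemma hasDerivAt_log_expGen (hc : ∀ k, 0 < c k)
    (hs : Summable fun k => c k * R ^ k / (k.factorial : ℝ)) {t : ℝ} (ht : t ∈ Ico 0 R) :
    HasDerivAt (fun t => Real.log (expGen c t))
      (expGen (fun k => c (k + 1)) t / expGen c t) t :=
  (hasDerivAt_expGen (fun k => (hc k).le) hs (by rw [abs_of_nonneg ht.1]; exact ht.2)).log
    (expGen_pos hc hs ht.1 ht.2.le).ne'

/-- A log-concave sequence has a log-concave exponential generating function. -/
lemma concaveOn_log_expGen (hc : ∀ k, 0 < c k)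
    (hs : Summable fun k => c k * R ^ k / (k.factorial : ℝ))
    (h : ∀ k, c k * c (k + 2) ≤ c (k + 1) ^ 2) :
    ConcaveOn ℝ (Ico 0 R) fun t => Real.log (expGen c t) := by
  have hanti : Antitone fun k => c (k + 1) / c k := antitone_nat_of_succ_le fun k => by
    rw [div_le_div_iff₀ (hc _) (hc _)]
    linarith [h k]
  refine AntitoneOn.concaveOn_of_deriv (convex_Ico 0 R)
    (fun t ht => (hasDerivAt_log_expGen hc hs ht).continuousAt.continuousWithinAt)
    (fun t ht => (hasDerivAt_log_expGen hc hs (interior_subset ht)).differentiableAt.differentiableWithinAt)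
    fun s hs' t ht' hst => ?_
  have ms := interior_subset hs'
  have mt := interior_subset ht'
  rw [(hasDerivAt_log_expGen hc hs ms).deriv, (hasDerivAt_log_expGen hc hs mt).deriv,
    div_le_div_iff₀ (expGen_pos hc hs mt.1 mt.2.le) (expGen_pos hc hs ms.1 ms.2.le)]
  refine expGen_mul_le_mul (fun k => (hc _).le) (fun k => (hc k).le) (fun i j hij => ?_) ms.1 hst
    (summable_expGen_succ (fun k => (hc k).le) hs mt.1 mt.2)
    (summable_expGen_of_le (fun k => (hc k).le) hs mt.1 mt.2.le)
  have := hanti hij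
  rwa [div_le_div_iff₀ (hc _) (hc _)] at this

/-- A log-convex sequence has a log-convex exponential generating function. -/
lemma convexOn_log_expGen (hc : ∀ k, 0 < c k)
    (hs : Summable fun k => c k * R ^ k / (k.factorial : ℝ))
    (h : ∀ k, c (k + 1) ^ 2 ≤ c k * c (k + 2)) :
    ConvexOn ℝ (Ico 0 R) fun t => Real.log (expGen c t) := by
  have hmono : Monotone fun k => c (k + 1) / c k := monotone_nat_of_le_succ fun k => by
    rw [div_le_div_iff₀ (hc _) (hc _)]
    linarith [h k]
  refine MonotoneOn.convexOn_of_deriv (convex_Ico 0 R)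
    (fun t ht => (hasDerivAt_log_expGen hc hs ht).continuousAt.continuousWithinAt)
    (fun t ht => (hasDerivAt_log_expGen hc hs (interior_subset ht)).differentiableAt.differentiableWithinAt)
    fun s hs' t ht' hst => ?_
  have ms := interior_subset hs'
  have mt := interior_subset ht'
  rw [(hasDerivAt_log_expGen hc hs ms).deriv, (hasDerivAt_log_expGen hc hs mt).deriv,
    div_le_div_iff₀ (expGen_pos hc hs ms.1 ms.2.le) (expGen_pos hc hs mt.1 mt.2.le)]
  have key := expGen_mul_le_mul (fun k => (hc k).le) (fun k => (hc (k + 1)).le)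
    (fun i j hij => by
      have := hmono hij
      rw [div_le_div_iff₀ (hc _) (hc _)] at this
      linarith) ms.1 hst
    (summable_expGen_of_le (fun k => (hc k).le) hs mt.1 mt.2.le)
    (summable_expGen_succ (fun k => (hc k).le) hs mt.1 mt.2)
  linarith

lemma expGen_zero : expGen c 0 = c 0 := by
  unfold expGen
  rw [tsum_eq_single 0 fun k hk => by simp [hk]]
  simp

/-- If the exponential generating function of `c` is log-affine then `c` is geometric up to
order two. -/
lemma mul_eq_sq_of_log_expGen_affine (hc : ∀ k, 0 < c k) (hR : 0 < R)
    (hs : Summable fun k => c k * R ^ k / (k.factorial : ℝ)) {m q : ℝ}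
    (h : ∀ t ∈ Ico 0 R, Real.log (expGen c t) = m * t + q) : c 0 * c 2 = c 1 ^ 2 := by
  have huniq : ∀ t ∈ Ico 0 R, UniqueDiffWithinAt ℝ (Ico 0 R) t := uniqueDiffOn_Ico 0 R
  have h1 : ∀ t ∈ Ico 0 R, expGen (fun k => c (k + 1)) t = m * expGen c t := by
    intro t ht
    have d1 := (hasDerivAt_log_expGen hc hs ht).hasDerivWithinAt (s := Ico 0 R)
    have d2 : HasDerivWithinAt (fun t => Real.log (expGen c t)) m (Ico 0 R) t := by
      have := (((hasDerivAt_id t).const_mul m).add_const q).hasDerivWithinAt (s := Ico 0 R)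
      rw [mul_one] at this
      exact this.congr h (h t ht)
    have := (huniq t ht).eq_deriv _ d1 d2
    rwa [div_eq_iff (expGen_pos hc hs ht.1 ht.2.le).ne'] at this
  have h0 : (0 : ℝ) ∈ Ico 0 R := ⟨le_rfl, hR⟩
  have hs' := summable_expGen_succ (fun k => (hc k).le) hs (half_pos hR).le (half_lt_self hR)
  have d1 := (hasDerivAt_expGen (t := 0) (fun k => (hc (k + 1)).le) hs'
    (by simpa using hR)).hasDerivWithinAt (s := Ico 0 R)
  have d2 := ((hasDerivAt_expGen (t := 0) (fun k => (hc k).le) hs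
    (by simpa using hR)).const_mul m).hasDerivWithinAt (s := Ico 0 R)
  have e2 := (huniq 0 h0).eq_deriv _ d1 (d2.congr h1 (h1 0 h0))
  have e1 := h1 0 h0
  simp only [expGen_zero] at e1 e2
  simp only [zero_add, one_add_one_eq_two] at e1 e2
  rw [e2, e1]
  ring

end

/-- The exponential generating function of a geometric sequence. -/
lemma expGen_geometric (a ρ t : ℝ) : expGen (fun k => a * ρ ^ k) t = a * Real.exp (ρ * t) := by
  rw [Real.exp_eq_exp_ℝ, NormedSpace.exp_eq_tsum_div, ← tsum_mul_left]
  refine tsum_congr fun k => ?_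
  rw [mul_pow]
  ring

/-- The normalized even moments of the density `exp (-κ |y| ^ p)`, with the normalization
of `muP`, scaled so that their exponential generating function is the Laplace transform. -/
def laplaceCoeff (p κ : ℝ) (k : ℕ) : ℝ :=
  (2 * p ^ (1/p) * Real.Gamma (1 + 1/p))⁻¹
    * (2 * (κ ^ (-((2 * k : ℕ) + 1 : ℝ) / p) * (1 / p) * Real.Gamma (((2 * k : ℕ) + 1 : ℝ) / p)))
    * k.factorial / (2 * k).factorial

lemma laplaceCoeff_pos {p κ : ℝ} (hp : 0 < p) (hκ : 0 < κ) (k : ℕ) : 0 < laplaceCoeff p κ k := by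
  have h1 : 0 < Real.Gamma (1 + 1 / p) := Real.Gamma_pos_of_pos (by positivity)
  have h2 : 0 < Real.Gamma (((2 * k : ℕ) + 1 : ℝ) / p) := Real.Gamma_pos_of_pos (by positivity)
  unfold laplaceCoeff
  positivity

lemma integral_even_pow_mul_exp {p κ : ℝ} (hp : 0 < p) (hκ : 0 < κ) (k : ℕ) :
    ∫ y : ℝ, y ^ (2 * k) * Real.exp (-κ * |y| ^ p)
      = 2 * (κ ^ (-((2 * k : ℕ) + 1 : ℝ) / p) * (1 / p)
          * Real.Gamma (((2 * k : ℕ) + 1 : ℝ) / p)) := by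
  rw [← integral_rpow_mul_exp_neg_mul_rpow hp
      (neg_one_lt_zero.trans_le (Nat.cast_nonneg _)) hκ, ← integral_comp_abs]
  congr 1
  ext y
  simp only [Real.rpow_natCast]
  rw [pow_mul, pow_mul, sq_abs]

lemma lintegral_even_pow_mul_exp {p κ : ℝ} (hp : 0 < p) (hκ : 0 < κ) (k : ℕ) :
    ∫⁻ y : ℝ, ENNReal.ofReal (y ^ (2 * k) * Real.exp (-κ * |y| ^ p))
      = ENNReal.ofReal (2 * (κ ^ (-((2 * k : ℕ) + 1 : ℝ) / p) * (1 / p)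
          * Real.Gamma (((2 * k : ℕ) + 1 : ℝ) / p))) := by
  have h2 : 0 < Real.Gamma (((2 * k : ℕ) + 1 : ℝ) / p) := Real.Gamma_pos_of_pos (by positivity)
  have hint := integral_even_pow_mul_exp hp hκ k
  rw [← hint, ofReal_integral_eq_lintegral_ofReal]
  · exact not_imp_comm.1 integral_undef (by rw [hint]; positivity)
  · refine ae_of_all _ fun y => ?_
    have : 0 ≤ y ^ (2 * k) := by rw [pow_mul]; positivity
    positivity

lemma lintegral_muP {p : ℝ} (t₂ s : ℝ) (hp : 0 < p) :
    ∫⁻ y, ENNReal.ofReal (Real.exp (s * y + t₂ * |y| ^ p)) ∂(muP p)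
      = ∫⁻ y, ENNReal.ofReal ((2 * p ^ (1/p) * Real.Gamma (1 + 1/p))⁻¹
          * Real.exp (s * y) * Real.exp (-(1 / p - t₂) * |y| ^ p)) := by
  have hZ : 0 < Real.Gamma (1 + 1 / p) := Real.Gamma_pos_of_pos (by positivity)
  rw [muP, lintegral_withDensity_eq_lintegral_mul _ (by fun_prop) (by fun_prop)]
  refine lintegral_congr fun y => ?_
  rw [Pi.mul_apply, ← ENNReal.ofReal_mul (by positivity)]
  generalize (2 * p ^ (1/p) * Real.Gamma (1 + 1/p))⁻¹ = Z
  rw [mul_assoc, mul_assoc, ← Real.exp_add, ← Real.exp_add]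
  congr 3
  ring

lemma lintegral_muP_eq_cosh {p : ℝ} (t₂ s : ℝ) (hp : 0 < p) :
    ∫⁻ y, ENNReal.ofReal (Real.exp (s * y + t₂ * |y| ^ p)) ∂(muP p)
      = ∫⁻ y, ENNReal.ofReal ((2 * p ^ (1/p) * Real.Gamma (1 + 1/p))⁻¹
          * Real.cosh (s * y) * Real.exp (-(1 / p - t₂) * |y| ^ p)) := by
  rw [lintegral_muP t₂ s hp]
  have hZ : 0 < Real.Gamma (1 + 1 / p) := Real.Gamma_pos_of_pos (by positivity)
  set Z := (2 * p ^ (1/p) * Real.Gamma (1 + 1/p))⁻¹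
  have hZ' : 0 < Z := by positivity
  set F : ℝ → ℝ≥0∞ := fun y => ENNReal.ofReal (Z * Real.exp (s * y)
    * Real.exp (-(1 / p - t₂) * |y| ^ p))
  have hF : Measurable F := by fun_prop
  have h1 : ∫⁻ y, F (-y) = ∫⁻ y, F y := lintegral_neg_eq_self F
  have h2 : ∫⁻ y, F y = ∫⁻ y, (F y + F (-y)) / 2 := by
    simp_rw [div_eq_mul_inv]
    rw [lintegral_mul_const _ (by fun_prop), lintegral_add_left hF, h1, ← two_mul, mul_comm,
      ← mul_assoc, ENNReal.inv_mul_cancel two_ne_zero ENNReal.ofNat_ne_top, one_mul]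
  rw [h2]
  refine lintegral_congr fun y => ?_
  simp only [F]
  rw [← ENNReal.ofReal_add (by positivity) (by positivity), ← ENNReal.ofReal_ofNat 2,
    ← ENNReal.ofReal_div_of_pos two_pos, Real.cosh_eq, abs_neg, mul_neg]
  congr 1
  ring

/-- The Laplace transform as a power series, in `ℝ≥0∞`. -/
lemma lintegral_muP_eq_tsum {p t₂ : ℝ} (hp : 0 < p) (ht : t₂ < 1 / p) {t : ℝ} (h0 : 0 ≤ t) :
    ∫⁻ y, ENNReal.ofReal (Real.exp (√t * y + t₂ * |y| ^ p)) ∂(muP p)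
      = ∑' k, ENNReal.ofReal (laplaceCoeff p (1 / p - t₂) k * t ^ k / (k.factorial : ℝ)) := by
  rw [lintegral_muP_eq_cosh t₂ _ hp]
  have hZ : 0 < Real.Gamma (1 + 1 / p) := Real.Gamma_pos_of_pos (by positivity)
  have hκ : 0 < 1 / p - t₂ := sub_pos.2 ht
  unfold laplaceCoeff
  set Z := (2 * p ^ (1/p) * Real.Gamma (1 + 1/p))⁻¹
  set κ := 1 / p - t₂
  have hZ' : 0 < Z := by positivity
  have hpt : ∀ y : ℝ, ENNReal.ofReal (Z * Real.cosh (√t * y) * Real.exp (-κ * |y| ^ p))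
      = ∑' k : ℕ, ENNReal.ofReal (Z * t ^ k / (2 * k).factorial)
          * ENNReal.ofReal (y ^ (2 * k) * Real.exp (-κ * |y| ^ p)) := by
    intro y
    have h1 := ((Real.hasSum_cosh (√t * y)).mul_left Z).mul_right (Real.exp (-κ * |y| ^ p))
    rw [← h1.tsum_eq, ENNReal.ofReal_tsum_of_nonneg _ h1.summable]
    · refine tsum_congr fun k => ?_
      rw [← ENNReal.ofReal_mul (by positivity), mul_pow, pow_mul (√t), Real.sq_sqrt h0]
      congr 1
      ring
    · intro k
      have : 0 ≤ (√t * y) ^ (2 * k) := by rw [pow_mul]; positivity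
      positivity
  simp_rw [hpt]
  rw [lintegral_tsum fun k => by fun_prop]
  refine tsum_congr fun k => ?_
  rw [lintegral_const_mul _ (by fun_prop), lintegral_even_pow_mul_exp hp hκ,
    ← ENNReal.ofReal_mul (by positivity)]
  congr 1
  have hf : (0 : ℝ) < k.factorial := by exact_mod_cast k.factorial_pos
  field_simp

lemma lintegral_muP_lt_top_of_le {p t₂ s C κ' : ℝ} (hp : 0 < p) (hκ' : 0 < κ')
    (h : ∀ y : ℝ, s * y + t₂ * |y| ^ p - |y| ^ p / p ≤ C - κ' * |y| ^ p) :
    ∫⁻ y, ENNReal.ofReal (Real.exp (s * y + t₂ * |y| ^ p)) ∂(muP p) < ⊤ := by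
  rw [lintegral_muP t₂ s hp]
  have hZ : 0 < Real.Gamma (1 + 1 / p) := Real.Gamma_pos_of_pos (by positivity)
  set Z := (2 * p ^ (1/p) * Real.Gamma (1 + 1/p))⁻¹
  have hZ' : 0 < Z := by positivity
  have h1 : ∀ y : ℝ, ENNReal.ofReal (Z * Real.exp (s * y) * Real.exp (-(1 / p - t₂) * |y| ^ p))
      ≤ ENNReal.ofReal (Z * Real.exp C)
        * ENNReal.ofReal (y ^ (2 * 0) * Real.exp (-κ' * |y| ^ p)) := by
    intro y
    rw [← ENNReal.ofReal_mul (by positivity)]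
    refine ENNReal.ofReal_le_ofReal ?_
    rw [mul_zero, pow_zero, one_mul, mul_assoc, mul_assoc, ← Real.exp_add, ← Real.exp_add]
    refine mul_le_mul_of_nonneg_left (Real.exp_le_exp.2 ?_) hZ'.le
    linear_combination h y
  refine (lintegral_mono h1).trans_lt ?_
  rw [lintegral_const_mul _ (by fun_prop), lintegral_even_pow_mul_exp hp hκ' 0]
  exact ENNReal.mul_lt_top ENNReal.ofReal_lt_top ENNReal.ofReal_lt_top

lemma lintegral_muP_lt_top {p t₂ : ℝ} (hp : 1 < p) (ht : t₂ < 1 / p) {s : ℝ} (hs : 0 ≤ s) :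
    ∫⁻ y, ENNReal.ofReal (Real.exp (s * y + t₂ * |y| ^ p)) ∂(muP p) < ⊤ := by
  have hκ : 0 < 1 / p - t₂ := sub_pos.2 ht
  have hp0 : 0 < p := by linarith
  have hp1 : 0 < p - 1 := by linarith
  set Y := (2 * s / (1 / p - t₂)) ^ (p - 1)⁻¹
  have hY : 0 ≤ Y := by positivity
  refine lintegral_muP_lt_top_of_le (C := s * Y) (κ' := (1 / p - t₂) / 2) hp0 (by positivity)
    fun y => ?_
  have hsy : s * y ≤ s * |y| := by gcongr; exact le_abs_self y
  have hyp : 0 ≤ |y| ^ p := by positivity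
  have key : s * |y| ≤ s * Y + (1 / p - t₂) / 2 * |y| ^ p := by
    rcases le_total |y| Y with h | h
    · have : s * |y| ≤ s * Y := by gcongr
      have : 0 ≤ (1 / p - t₂) / 2 * |y| ^ p := by positivity
      linarith
    · have h1 : Y ^ (p - 1) ≤ |y| ^ (p - 1) := Real.rpow_le_rpow hY h hp1.le
      rw [← Real.rpow_mul (by positivity), inv_mul_cancel₀ hp1.ne', Real.rpow_one,
        div_le_iff₀ hκ] at h1
      have h2 : |y| ^ p = |y| ^ (p - 1) * |y| := by
        rcases (abs_nonneg y).eq_or_lt with h0 | h0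
        · rw [← h0, mul_zero, Real.zero_rpow hp0.ne']
        · rw [← Real.rpow_add_one h0.ne', sub_add_cancel]
      have h3 := mul_le_mul_of_nonneg_right h1 (abs_nonneg y)
      have h4 : 0 ≤ s * Y := by positivity
      rw [h2]
      linarith
  have : |y| ^ p / p = 1 / p * |y| ^ p := by ring
  linarith

lemma lintegral_muP_one_lt_top {t₂ s : ℝ} (hs : 0 ≤ s) (h : s < 1 - t₂) :
    ∫⁻ y, ENNReal.ofReal (Real.exp (s * y + t₂ * |y| ^ (1 : ℝ))) ∂(muP 1) < ⊤ := by
  refine lintegral_muP_lt_top_of_le (C := 0) (κ' := 1 - t₂ - s) one_pos (by linarith) fun y => ?_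
  have hsy : s * y ≤ s * |y| := by gcongr; exact le_abs_self y
  rw [Real.rpow_one]
  linarith

lemma lintegral_muP_one_eq_top {t₂ s : ℝ} (h : 1 - t₂ ≤ s) :
    ∫⁻ y, ENNReal.ofReal (Real.exp (s * y + t₂ * |y| ^ (1 : ℝ))) ∂(muP 1) = ⊤ := by
  rw [lintegral_muP t₂ s one_pos, eq_top_iff]
  have hZ : 0 < Real.Gamma (1 + 1 / 1) := Real.Gamma_pos_of_pos (by positivity)
  set Z : ℝ := (2 * 1 ^ (1 / 1 : ℝ) * Real.Gamma (1 + 1/1))⁻¹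
  have hZ' : 0 < Z := by positivity
  calc (⊤ : ℝ≥0∞) = ∫⁻ _ in Ioi (0 : ℝ), ENNReal.ofReal Z := by
        rw [setLIntegral_const, Real.volume_Ioi, ENNReal.mul_top]
        simpa using hZ'
    _ ≤ ∫⁻ y in Ioi (0 : ℝ), ENNReal.ofReal (Z * Real.exp (s * y)
          * Real.exp (-(1 / 1 - t₂) * |y| ^ (1 : ℝ))) := by
        refine setLIntegral_mono (by fun_prop) fun y hy => ENNReal.ofReal_le_ofReal ?_
        have hy' : (0 : ℝ) < y := hy
        rw [mul_assoc, ← Real.exp_add, Real.rpow_one, abs_of_pos hy']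
        refine le_mul_of_one_le_right hZ'.le (Real.one_le_exp ?_)
        nlinarith
    _ ≤ _ := setLIntegral_le_lintegral _ _

lemma laplaceCoeff_eq (p κ : ℝ) (k : ℕ) :
    laplaceCoeff p κ k = (2 * p ^ (1/p) * Real.Gamma (1 + 1/p))⁻¹ * (2 / p)
      * κ ^ (-(2 / p * (k + 1 / 2 : ℝ))) * Real.Gamma (2 / p * (k + 1 / 2))
      * (k.factorial / (2 * k).factorial) := by
  unfold laplaceCoeff
  rw [show ((2 * k : ℕ) + 1 : ℝ) / p = 2 / p * (k + 1 / 2) by push_cast; ring,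
    show -((2 * k : ℕ) + 1 : ℝ) / p = -(2 / p * (k + 1 / 2)) by push_cast; ring]
  ring

lemma factorial_div_factorial_two_mul_succ (k : ℕ) :
    ((k + 1).factorial : ℝ) / (2 * (k + 1)).factorial
      = k.factorial / (2 * k).factorial / (4 * (k + 1 / 2)) := by
  rw [show 2 * (k + 1) = 2 * k + 1 + 1 by ring]
  simp only [Nat.factorial_succ]
  push_cast
  have h1 : (0 : ℝ) < (2 * k).factorial := by exact_mod_cast (2 * k).factorial_pos
  have h2 : (0 : ℝ) < k.factorial := by exact_mod_cast k.factorial_pos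
  field_simp
  ring

lemma laplaceCoeff_mul_laplaceCoeff {p κ : ℝ} (hκ : 0 < κ) (k : ℕ) :
    laplaceCoeff p κ k * laplaceCoeff p κ (k + 2)
        * ((k + 1 / 2 + 1) * Real.Gamma (2 / p * (k + 1 / 2 + 1)) ^ 2)
      = laplaceCoeff p κ (k + 1) ^ 2
        * ((k + 1 / 2) * (Real.Gamma (2 / p * (k + 1 / 2))
          * Real.Gamma (2 / p * (k + 1 / 2 + 2)))) := by
  simp only [laplaceCoeff_eq]
  rw [factorial_div_factorial_two_mul_succ (k + 1), factorial_div_factorial_two_mul_succ k]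
  push_cast
  rw [show (k + 2 + 1 / 2 : ℝ) = k + 1 / 2 + 2 by ring,
    show (k + 1 + 1 / 2 : ℝ) = k + 1 / 2 + 1 by ring]
  have hx : (0 : ℝ) < k + 1 / 2 := by positivity
  generalize (k + 1 / 2 : ℝ) = x at *
  generalize (k.factorial : ℝ) / (2 * k).factorial = e
  have hpow : κ ^ (-(2 / p * x)) * κ ^ (-(2 / p * (x + 2))) = (κ ^ (-(2 / p * (x + 1)))) ^ 2 := by
    rw [← Real.rpow_add hκ, ← Real.rpow_natCast, ← Real.rpow_mul hκ.le]
    congr 1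
    push_cast
    ring
  generalize (2 * p ^ (1/p) * Real.Gamma (1 + 1/p))⁻¹ * (2 / p) = K
  generalize Real.Gamma (2 / p * x) = G0
  generalize Real.Gamma (2 / p * (x + 1)) = G1
  generalize Real.Gamma (2 / p * (x + 2)) = G2
  calc _ = K ^ 2 * (κ ^ (-(2 / p * x)) * κ ^ (-(2 / p * (x + 2)))) * G0 * G2 * G1 ^ 2
        * (e ^ 2 * ((x + 1) / (4 * x) / (4 * (x + 1)))) := by ring
    _ = _ := by
      rw [hpow]
      field_simp

lemma gamma_two_step_unit {x : ℝ} (hx : 0 < x) :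
    0 < Real.Gamma x ∧ Real.Gamma (1 * (x + 1)) = x * Real.Gamma x
      ∧ Real.Gamma (1 * (x + 2)) = (x + 1) * (x * Real.Gamma x) := by
  refine ⟨Real.Gamma_pos_of_pos hx, ?_, ?_⟩
  · rw [one_mul, Real.Gamma_add_one hx.ne']
  · rw [one_mul, show x + 2 = x + 1 + 1 by ring, Real.Gamma_add_one (by positivity),
      Real.Gamma_add_one hx.ne']

/-- For `p > 2` the normalized moments are strictly log-concave. -/
lemma laplaceCoeff_mul_lt {p κ : ℝ} (hp : 2 < p) (hκ : 0 < κ) (k : ℕ) :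
    laplaceCoeff p κ k * laplaceCoeff p κ (k + 2) < laplaceCoeff p κ (k + 1) ^ 2 := by
  have hp0 : 0 < p := by linarith
  have hx : (0 : ℝ) < k + 1 / 2 := by positivity
  have h := gamma_mul_gamma_mul_sq_lt hx (by positivity : 0 < 2 / p) ((div_lt_one hp0).2 hp)
  have hE := laplaceCoeff_mul_laplaceCoeff (p := p) hκ k
  have hc : 0 < laplaceCoeff p κ (k + 1) ^ 2 := by
    have := laplaceCoeff_pos hp0 hκ (k + 1); positivity
  generalize (k + 1 / 2 : ℝ) = x at *
  obtain ⟨hG, e1, e2⟩ := gamma_two_step_unit hx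
  rw [e1, e2, one_mul] at h
  have hG1 : 0 < Real.Gamma (2 / p * (x + 1)) := Real.Gamma_pos_of_pos (by positivity)
  have h' : x * (Real.Gamma (2 / p * x) * Real.Gamma (2 / p * (x + 2)))
      < (x + 1) * Real.Gamma (2 / p * (x + 1)) ^ 2 := by
    have hm : 0 < x * Real.Gamma x ^ 2 := by positivity
    refine lt_of_mul_lt_mul_left ?_ hm.le
    linear_combination h
  refine lt_of_mul_lt_mul_right ?_
    (by positivity : 0 ≤ (x + 1) * Real.Gamma (2 / p * (x + 1)) ^ 2)
  rw [hE]
  gcongr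

/-- For `p < 2` the normalized moments are strictly log-convex. -/
lemma laplaceCoeff_sq_lt {p κ : ℝ} (hp0 : 0 < p) (hp : p < 2) (hκ : 0 < κ) (k : ℕ) :
    laplaceCoeff p κ (k + 1) ^ 2 < laplaceCoeff p κ k * laplaceCoeff p κ (k + 2) := by
  have hx : (0 : ℝ) < k + 1 / 2 := by positivity
  have h := gamma_mul_gamma_mul_sq_lt hx one_pos ((one_lt_div hp0).2 hp)
  have hE := laplaceCoeff_mul_laplaceCoeff (p := p) hκ k
  have hc : 0 < laplaceCoeff p κ (k + 1) ^ 2 := by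
    have := laplaceCoeff_pos hp0 hκ (k + 1); positivity
  generalize (k + 1 / 2 : ℝ) = x at *
  obtain ⟨hG, e1, e2⟩ := gamma_two_step_unit hx
  rw [e1, e2, one_mul] at h
  have hG1 : 0 < Real.Gamma (2 / p * (x + 1)) := Real.Gamma_pos_of_pos (by positivity)
  have h' : (x + 1) * Real.Gamma (2 / p * (x + 1)) ^ 2
      < x * (Real.Gamma (2 / p * x) * Real.Gamma (2 / p * (x + 2))) := by
    have hm : 0 < x * Real.Gamma x ^ 2 := by positivity
    refine lt_of_mul_lt_mul_left ?_ hm.le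
    linear_combination h
  refine lt_of_mul_lt_mul_right ?_
    (by positivity : 0 ≤ (x + 1) * Real.Gamma (2 / p * (x + 1)) ^ 2)
  rw [hE]
  gcongr

/-- In the Gaussian case the normalized moments form a geometric sequence. -/
lemma laplaceCoeff_two {κ : ℝ} (hκ : 0 < κ) (k : ℕ) :
    laplaceCoeff 2 κ k = laplaceCoeff 2 κ 0 * (4 * κ)⁻¹ ^ k := by
  induction k with
  | zero => simp
  | succ k ih =>
    rw [pow_succ, ← mul_assoc, ← ih]
    simp only [laplaceCoeff_eq]
    rw [factorial_div_factorial_two_mul_succ]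
    push_cast
    rw [show (k + 1 + 1 / 2 : ℝ) = k + 1 / 2 + 1 by ring]
    have hx : (0 : ℝ) < k + 1 / 2 := by positivity
    generalize (k + 1 / 2 : ℝ) = x at *
    rw [div_self two_ne_zero, one_mul, one_mul, Real.Gamma_add_one hx.ne', neg_add,
      Real.rpow_add hκ, Real.rpow_neg_one]
    field_simp

section

variable {p t₂ : ℝ}

lemma lintegral_muP_ne_zero (hp : 0 < p) (ht : t₂ < 1 / p) {t : ℝ} (h0 : 0 ≤ t) :
    ∫⁻ y, ENNReal.ofReal (Real.exp (√t * y + t₂ * |y| ^ p)) ∂(muP p) ≠ 0 := by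
  rw [lintegral_muP_eq_tsum hp ht h0]
  intro h
  have := ENNReal.tsum_eq_zero.1 h 0
  have hc := laplaceCoeff_pos hp (sub_pos.2 ht) 0
  simp only [pow_zero, mul_one, Nat.factorial_zero, Nat.cast_one, div_one,
    ENNReal.ofReal_eq_zero] at this
  linarith

lemma summable_laplaceCoeff (hp : 0 < p) (ht : t₂ < 1 / p) {t : ℝ} (h0 : 0 ≤ t)
    (h : ∫⁻ y, ENNReal.ofReal (Real.exp (√t * y + t₂ * |y| ^ p)) ∂(muP p) < ⊤) :
    Summable fun k => laplaceCoeff p (1 / p - t₂) k * t ^ k / (k.factorial : ℝ) := by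
  rw [lintegral_muP_eq_tsum hp ht h0] at h
  refine (ENNReal.summable_toReal h.ne).congr fun k => ENNReal.toReal_ofReal ?_
  have := laplaceCoeff_pos hp (sub_pos.2 ht) k
  positivity

lemma LamP_eq_log_expGen (hp : 0 < p) (ht : t₂ < 1 / p) {t : ℝ} (h0 : 0 ≤ t)
    (hs : Summable fun k => laplaceCoeff p (1 / p - t₂) k * t ^ k / (k.factorial : ℝ)) :
    LamP p (√t, t₂) = (Real.log (expGen (laplaceCoeff p (1 / p - t₂)) t) : EReal) := by
  have hc := laplaceCoeff_pos hp (sub_pos.2 ht)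
  unfold LamP
  rw [lintegral_muP_eq_tsum hp ht h0, ← ENNReal.ofReal_tsum_of_nonneg _ hs]
  · exact ENNReal.log_ofReal_of_pos (expGen_pos hc hs h0 le_rfl)
  · intro k
    have := hc k
    positivity

/-- Finiteness of the Laplace transform is an open condition. -/
lemma exists_summable_laplaceCoeff (hp : 1 ≤ p) (ht : t₂ < 1 / p) {t : ℝ} (h0 : 0 ≤ t)
    (h : ∫⁻ y, ENNReal.ofReal (Real.exp (√t * y + t₂ * |y| ^ p)) ∂(muP p) < ⊤) :
    ∃ R, t < R ∧
      Summable fun k => laplaceCoeff p (1 / p - t₂) k * R ^ k / (k.factorial : ℝ) := by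
  rcases hp.eq_or_lt with rfl | hp1
  · have h1 : √t < 1 - t₂ := by
      by_contra! h'
      exact h.ne (lintegral_muP_one_eq_top h')
    have hκ : 0 < 1 - t₂ := (Real.sqrt_nonneg t).trans_lt h1
    obtain ⟨R, hR1, hR2⟩ := exists_between ((Real.sqrt_lt' hκ).1 h1)
    have hR0 : 0 ≤ R := h0.trans hR1.le
    exact ⟨R, hR1, summable_laplaceCoeff one_pos ht hR0
      (lintegral_muP_one_lt_top (Real.sqrt_nonneg R) ((Real.sqrt_lt' hκ).2 hR2))⟩
  · exact ⟨t + 1, by linarith, summable_laplaceCoeff (by linarith) ht (by linarith)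
      (lintegral_muP_lt_top hp1 ht (Real.sqrt_nonneg _))⟩

lemma not_affineOnE_LamP (hp : 1 ≤ p) (ht : t₂ < 1 / p)
    (hne : laplaceCoeff p (1 / p - t₂) 0 * laplaceCoeff p (1 / p - t₂) 2
      ≠ laplaceCoeff p (1 / p - t₂) 1 ^ 2) :
    ¬ AffineOnE (Set.Ici 0) (fun t => LamP p (√t, t₂)) := by
  rintro ⟨m, q, h⟩
  have hp0 : 0 < p := by linarith
  have hc := laplaceCoeff_pos hp0 (sub_pos.2 ht)
  have hfin : ∫⁻ y, ENNReal.ofReal (Real.exp (√0 * y + t₂ * |y| ^ p)) ∂(muP p) < ⊤ := by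
    by_contra! h'
    have := h 0 self_mem_Ici
    simp only [LamP] at this
    rw [top_le_iff.1 h', ENNReal.log_top] at this
    exact EReal.coe_ne_top _ this.symm
  obtain ⟨R, hR, hs⟩ := exists_summable_laplaceCoeff hp ht le_rfl hfin
  refine hne (mul_eq_sq_of_log_expGen_affine (m := m) (q := q) hc hR hs fun t htR => ?_)
  have h1 := h t htR.1
  simp only at h1
  rw [LamP_eq_log_expGen hp0 ht htR.1
    (summable_expGen_of_le (fun k => (hc k).le) hs htR.1 htR.2.le)] at h1
  exact_mod_cast h1

lemma concaveOnE_LamP (hp : 2 < p) (ht : t₂ < 1 / p) :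
    ConcaveOnE (Set.Ici 0) (fun t => LamP p (√t, t₂)) := by
  intro x hx y hy a b ha hb hab
  have hp0 : 0 < p := by linarith
  have hκ := sub_pos.2 ht
  have hs : ∀ t : ℝ, 0 ≤ t →
      Summable fun k => laplaceCoeff p (1 / p - t₂) k * t ^ k / (k.factorial : ℝ) := fun t h0 =>
    summable_laplaceCoeff hp0 ht h0 (lintegral_muP_lt_top (by linarith) ht (Real.sqrt_nonneg _))
  have hx0 : 0 ≤ x := hx
  have hy0 : 0 ≤ y := hy
  have hR : 0 ≤ x + y + 1 := by linarith
  have h := (concaveOn_log_expGen (laplaceCoeff_pos hp0 hκ) (hs _ hR)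
    fun k => (laplaceCoeff_mul_lt hp hκ k).le).2
    (⟨hx, by linarith⟩ : x ∈ Ico 0 (x + y + 1)) ⟨hy, by linarith⟩ ha hb hab
  simp only [smul_eq_mul] at h
  simp only
  rw [LamP_eq_log_expGen hp0 ht hx0 (hs _ hx0), LamP_eq_log_expGen hp0 ht hy0 (hs _ hy0),
    LamP_eq_log_expGen hp0 ht (by positivity) (hs _ (by positivity))]
  exact_mod_cast h

lemma LamP_ne_bot (hp : 0 < p) (ht : t₂ < 1 / p) {t : ℝ} (h0 : 0 ≤ t) :
    LamP p (√t, t₂) ≠ ⊥ := fun h =>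
  lintegral_muP_ne_zero hp ht h0 (ENNReal.log_eq_bot_iff.1 h)

lemma coe_mul_top_add_coe_mul {a b : ℝ} (ha : 0 < a) (hb : 0 < b) {z : EReal} (hz : z ≠ ⊥) :
    (a : EReal) * ⊤ + (b : EReal) * z = ⊤ := by
  rw [EReal.coe_mul_top_of_pos ha]
  refine EReal.top_add_of_ne_bot ?_
  induction z with
  | bot => exact absurd rfl hz
  | coe z => exact_mod_cast EReal.coe_ne_bot (b * z)
  | top => simp [EReal.coe_mul_top_of_pos hb]

lemma convexOnE_LamP (hp1 : 1 ≤ p) (hp : p < 2) (ht : t₂ < 1 / p) :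
    ConvexOnE (Set.Ici 0) (fun t => LamP p (√t, t₂)) := by
  intro x hx y hy a b ha hb hab
  have hp0 : 0 < p := by linarith
  have hκ := sub_pos.2 ht
  have hx0 : 0 ≤ x := hx
  have hy0 : 0 ≤ y := hy
  simp only
  rcases ha.eq_or_lt with rfl | ha'
  · obtain rfl : b = 1 := by linarith
    simp
  rcases hb.eq_or_lt with rfl | hb'
  · obtain rfl : a = 1 := by linarith
    simp
  by_cases hfx : LamP p (√x, t₂) = ⊤
  · rw [hfx, coe_mul_top_add_coe_mul ha' hb' (LamP_ne_bot hp0 ht hy0)]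
    exact le_top
  by_cases hfy : LamP p (√y, t₂) = ⊤
  · rw [hfy, add_comm ((a : EReal) * _), coe_mul_top_add_coe_mul hb' ha' (LamP_ne_bot hp0 ht hx0)]
    exact le_top
  have hfin : ∀ t : ℝ, LamP p (√t, t₂) ≠ ⊤ →
      ∫⁻ y, ENNReal.ofReal (Real.exp (√t * y + t₂ * |y| ^ p)) ∂(muP p) < ⊤ := fun t h =>
    lt_top_iff_ne_top.2 fun h' => h (ENNReal.log_eq_top_iff.2 h')
  obtain ⟨R, hxR, hyR, hs⟩ : ∃ R, x < R ∧ y < R ∧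
      Summable fun k => laplaceCoeff p (1 / p - t₂) k * R ^ k / (k.factorial : ℝ) := by
    rcases le_total x y with hxy | hxy
    · obtain ⟨R, hR, hs⟩ := exists_summable_laplaceCoeff hp1 ht hy0 (hfin y hfy)
      exact ⟨R, hxy.trans_lt hR, hR, hs⟩
    · obtain ⟨R, hR, hs⟩ := exists_summable_laplaceCoeff hp1 ht hx0 (hfin x hfx)
      exact ⟨R, hR, hxy.trans_lt hR, hs⟩
  have hc := laplaceCoeff_pos hp0 hκ
  have hC := convexOn_log_expGen hc hs fun k => (laplaceCoeff_sq_lt hp0 hp hκ k).le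
  have mx : x ∈ Ico 0 R := ⟨hx0, hxR⟩
  have my : y ∈ Ico 0 R := ⟨hy0, hyR⟩
  have mz : a * x + b * y ∈ Ico 0 R := hC.1 mx my ha hb hab
  have h := hC.2 mx my ha hb hab
  simp only [smul_eq_mul] at h
  have heq : ∀ t ∈ Ico 0 R, LamP p (√t, t₂)
      = (Real.log (expGen (laplaceCoeff p (1 / p - t₂)) t) : EReal) := fun t m =>
    LamP_eq_log_expGen hp0 ht m.1 (summable_expGen_of_le (fun k => (hc k).le) hs m.1 m.2.le)
  rw [heq x mx, heq y my, heq _ mz]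
  exact_mod_cast h

lemma affineOnE_LamP_two (ht : t₂ < 1 / 2) :
    AffineOnE (Set.Ici 0) (fun t => LamP 2 (√t, t₂)) := by
  have hκ : 0 < 1 / 2 - t₂ := sub_pos.2 ht
  have hc := laplaceCoeff_pos two_pos hκ 0
  refine ⟨(4 * (1 / 2 - t₂))⁻¹, Real.log (laplaceCoeff 2 (1 / 2 - t₂) 0), fun t h0 => ?_⟩
  simp only
  rw [LamP_eq_log_expGen two_pos ht h0 (summable_laplaceCoeff two_pos ht h0
    (lintegral_muP_lt_top one_lt_two ht (Real.sqrt_nonneg _))),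
    funext (laplaceCoeff_two hκ), expGen_geometric, Real.log_mul hc.ne' (Real.exp_ne_zero _),
    Real.log_exp, add_comm]
  simp

end

/-- Concavity/affinity/convexity of `t ↦ Λ_p(√t, t₂)` on `[0,∞)`. -/
theorem statement16 (p : ℝ) (hp : 1 ≤ p) (t₂ : ℝ) (ht : t₂ < 1/p) :
    (2 < p → ConcaveOnE (Set.Ici 0) (fun t => LamP p (Real.sqrt t, t₂))
        ∧ ¬ AffineOnE (Set.Ici 0) (fun t => LamP p (Real.sqrt t, t₂)))
    ∧ (p = 2 → AffineOnE (Set.Ici 0) (fun t => LamP p (Real.sqrt t, t₂)))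
    ∧ (p < 2 → ConvexOnE (Set.Ici 0) (fun t => LamP p (Real.sqrt t, t₂))
        ∧ ¬ AffineOnE (Set.Ici 0) (fun t => LamP p (Real.sqrt t, t₂))) := by
  have hp0 : 0 < p := by linarith
  have hκ := sub_pos.2 ht
  refine ⟨fun h => ⟨concaveOnE_LamP h ht, not_affineOnE_LamP hp ht (laplaceCoeff_mul_lt h hκ 0).ne⟩,
    fun h => ?_, fun h => ⟨convexOnE_LamP hp h ht,
      not_affineOnE_LamP hp ht (laplaceCoeff_sq_lt hp0 h hκ 0).ne'⟩⟩
  subst h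
  exact affineOnE_LamP_two ht
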